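/- arXiv:2006.13840 — 5 statements merged into one kernel-verified Lean document; each statement's English description precedes it below -/
import Mathlib

section
/- For every real number y with -π ≤ y ≤ π, the product (sin y - y + y³/6)(sin y - y + y³/10) ≤ 0; that is, sin y lies in the generalised sector bounded by the cubic polynomials y - y³/6 and y - y³/10 on [-π, π]. -/
theorem aux_mono (f f' : ℝ → ℝ) (hf : ∀ x, HasDerivAt f (f' x) x) (h0 : f 0 = 0)
    (hp : ∀ x, 0 ≤ x → 0 ≤ f' x) (x : ℝ) (hx : 0 ≤ x) : 0 ≤ f x := by
  have hm : MonotoneOn f (Set.Ici 0) := by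
    apply monotoneOn_of_deriv_nonneg (convex_Ici 0)
    · exact fun z _ => (hf z).continuousAt.continuousWithinAt
    · exact fun z _ => (hf z).differentiableAt.differentiableWithinAt
    · intro z hz
      rw [(hf z).deriv]
      rw [interior_Ici] at hz
      exact hp z (le_of_lt hz)
  have := hm (Set.mem_Ici.2 le_rfl) (Set.mem_Ici.2 hx) hx
  linarith

theorem aux_sin3 (x : ℝ) (hx : 0 ≤ x) : 0 ≤ Real.sin x - x + x ^ 3 / 6 := by
  refine aux_mono (fun x => Real.sin x - x + x ^ 3 / 6) (fun x => Real.cos x - 1 + x ^ 2 / 2)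
    (fun z => ?_) (by simp) (fun z _ => by linarith [Real.one_sub_sq_div_two_le_cos (x := z)]) x hx
  refine HasDerivAt.congr_deriv (((Real.hasDerivAt_sin z).sub (hasDerivAt_id z)).add
    ((hasDerivAt_pow 3 z).div_const 6)) ?_
  norm_num
  ring

theorem aux_cos4 (x : ℝ) (hx : 0 ≤ x) : 0 ≤ 1 - x ^ 2 / 2 + x ^ 4 / 24 - Real.cos x := by
  refine aux_mono (fun x => 1 - x ^ 2 / 2 + x ^ 4 / 24 - Real.cos x)
    (fun x => Real.sin x - x + x ^ 3 / 6) (fun z => ?_) (by simp) aux_sin3 x hx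
  refine HasDerivAt.congr_deriv ((((hasDerivAt_const z (1:ℝ)).sub ((hasDerivAt_pow 2 z).div_const 2)).add
    ((hasDerivAt_pow 4 z).div_const 24)).sub (Real.hasDerivAt_cos z)) ?_
  norm_num
  ring

theorem aux_sin5 (x : ℝ) (hx : 0 ≤ x) : 0 ≤ x - x ^ 3 / 6 + x ^ 5 / 120 - Real.sin x := by
  refine aux_mono (fun x => x - x ^ 3 / 6 + x ^ 5 / 120 - Real.sin x)
    (fun x => 1 - x ^ 2 / 2 + x ^ 4 / 24 - Real.cos x) (fun z => ?_) (by simp) aux_cos4 x hx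
  refine HasDerivAt.congr_deriv ((((hasDerivAt_id z).sub ((hasDerivAt_pow 3 z).div_const 6)).add
    ((hasDerivAt_pow 5 z).div_const 120)).sub (Real.hasDerivAt_sin z)) ?_
  norm_num
  ring

theorem aux_cos6 (x : ℝ) (hx : 0 ≤ x) :
    0 ≤ Real.cos x - 1 + x ^ 2 / 2 - x ^ 4 / 24 + x ^ 6 / 720 := by
  refine aux_mono (fun x => Real.cos x - 1 + x ^ 2 / 2 - x ^ 4 / 24 + x ^ 6 / 720)
    (fun x => x - x ^ 3 / 6 + x ^ 5 / 120 - Real.sin x) (fun z => ?_) (by simp) aux_sin5 x hx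
  refine HasDerivAt.congr_deriv (((((Real.hasDerivAt_cos z).sub (hasDerivAt_const z (1:ℝ))).add
    ((hasDerivAt_pow 2 z).div_const 2)).sub ((hasDerivAt_pow 4 z).div_const 24)).add
    ((hasDerivAt_pow 6 z).div_const 720)) ?_
  norm_num
  ring

theorem aux_sin7 (x : ℝ) (hx : 0 ≤ x) :
    0 ≤ Real.sin x - x + x ^ 3 / 6 - x ^ 5 / 120 + x ^ 7 / 5040 := by
  refine aux_mono (fun x => Real.sin x - x + x ^ 3 / 6 - x ^ 5 / 120 + x ^ 7 / 5040)
    (fun x => Real.cos x - 1 + x ^ 2 / 2 - x ^ 4 / 24 + x ^ 6 / 720)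
    (fun z => ?_) (by simp) aux_cos6 x hx
  refine HasDerivAt.congr_deriv (((((Real.hasDerivAt_sin z).sub (hasDerivAt_id z)).add
    ((hasDerivAt_pow 3 z).div_const 6)).sub ((hasDerivAt_pow 5 z).div_const 120)).add
    ((hasDerivAt_pow 7 z).div_const 5040)) ?_
  norm_num
  ring

theorem aux_cos8 (x : ℝ) (hx : 0 ≤ x) :
    0 ≤ 1 - x ^ 2 / 2 + x ^ 4 / 24 - x ^ 6 / 720 + x ^ 8 / 40320 - Real.cos x := by
  refine aux_mono (fun x => 1 - x ^ 2 / 2 + x ^ 4 / 24 - x ^ 6 / 720 + x ^ 8 / 40320 - Real.cos x)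
    (fun x => Real.sin x - x + x ^ 3 / 6 - x ^ 5 / 120 + x ^ 7 / 5040)
    (fun z => ?_) (by simp) aux_sin7 x hx
  refine HasDerivAt.congr_deriv ((((((hasDerivAt_const z (1:ℝ)).sub ((hasDerivAt_pow 2 z).div_const 2)).add
    ((hasDerivAt_pow 4 z).div_const 24)).sub ((hasDerivAt_pow 6 z).div_const 720)).add
    ((hasDerivAt_pow 8 z).div_const 40320)).sub (Real.hasDerivAt_cos z)) ?_
  norm_num
  ring

theorem aux_sin9 (x : ℝ) (hx : 0 ≤ x) :
    0 ≤ x - x ^ 3 / 6 + x ^ 5 / 120 - x ^ 7 / 5040 + x ^ 9 / 362880 - Real.sin x := by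
  refine aux_mono
    (fun x => x - x ^ 3 / 6 + x ^ 5 / 120 - x ^ 7 / 5040 + x ^ 9 / 362880 - Real.sin x)
    (fun x => 1 - x ^ 2 / 2 + x ^ 4 / 24 - x ^ 6 / 720 + x ^ 8 / 40320 - Real.cos x)
    (fun z => ?_) (by simp) aux_cos8 x hx
  refine HasDerivAt.congr_deriv ((((((hasDerivAt_id z).sub ((hasDerivAt_pow 3 z).div_const 6)).add
    ((hasDerivAt_pow 5 z).div_const 120)).sub ((hasDerivAt_pow 7 z).div_const 5040)).add
    ((hasDerivAt_pow 9 z).div_const 362880)).sub (Real.hasDerivAt_sin z)) ?_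
  norm_num
  ring

theorem aux_poly (t : ℝ) (h0 : 0 ≤ t) (h1 : t ≤ 9.87) :
    0 ≤ 1 / 15 - t / 120 + t ^ 2 / 5040 - t ^ 3 / 362880 := by
  obtain ⟨s, rfl⟩ : ∃ s, t = 9.87 - s := ⟨9.87 - t, by ring⟩
  have hs : 0 ≤ s := by linarith
  have h3 : 0 ≤ s ^ 3 := by positivity
  have h2 : 0 ≤ s ^ 2 := by positivity
  ring_nf
  nlinarith

theorem aux_pos (y : ℝ) (h1 : 0 ≤ y) (h2 : y ≤ Real.pi) :
    (Real.sin y - y + y ^ 3 / 6) * (Real.sin y - y + y ^ 3 / 10) ≤ 0 := by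
  apply mul_nonpos_of_nonneg_of_nonpos (aux_sin3 y h1)
  have h9 := aux_sin9 y h1
  have hy : y ≤ 3.1416 := h2.trans Real.pi_lt_d4.le
  have hp := mul_nonneg (pow_nonneg h1 3) (aux_poly (y ^ 2) (sq_nonneg y) (by nlinarith))
  ring_nf at hp h9 ⊢
  linarith

/-- For every real `y` with `-π ≤ y ≤ π`, the product
`(sin y - y + y³/6)(sin y - y + y³/10) ≤ 0`; i.e. `sin y` lies in the generalised
sector bounded by the cubics `y - y³/6` and `y - y³/10` on `[-π, π]`. -/
theorem sin_generalised_sector (y : ℝ) (h1 : -Real.pi ≤ y) (h2 : y ≤ Real.pi) :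
    (Real.sin y - y + y ^ 3 / 6) * (Real.sin y - y + y ^ 3 / 10) ≤ 0 := by
  rcases le_total 0 y with h | h
  · exact aux_pos y h h2
  · have := aux_pos (-y) (by linarith) (by linarith)
    rw [Real.sin_neg] at this
    nlinarith [this]
end

section
/- For every c ∈ ℝ and every y ∈ [-π - c, π - c], the shifted sinusoidal nonlinearity satisfies the generalised sector bound (φ(y; c) - η₁(y; c))(φ(y; c) - η₂(y; c)) ≤ 0. -/
/-- Shifted sinusoidal nonlinearity `φ(y; c) = sin(y + c) − sin c`. -/
noncomputable def phi (y c : ℝ) : ℝ := Real.sin (y + c) - Real.sin c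

/-- Lower bounding polynomial `η₁(y; c) = (y + c) − (y + c)³/6 − sin c`. -/
noncomputable def eta1 (y c : ℝ) : ℝ := (y + c) - (y + c) ^ 3 / 6 - Real.sin c

/-- Upper bounding polynomial `η₂(y; c) = (y + c) − (y + c)³/10 − sin c`. -/
noncomputable def eta2 (y c : ℝ) : ℝ := (y + c) - (y + c) ^ 3 / 10 - Real.sin c

theorem cos_le_taylor {x : ℝ} (hx : 0 ≤ x) :
    Real.cos x ≤ 1 - x ^ 2 / 2 + x ^ 4 / 24 := by
  have hd : ∀ t : ℝ, HasDerivAt (fun t : ℝ => 1 - t ^ 2 / 2 + t ^ 4 / 24 - Real.cos t)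
      (Real.sin t - (t - t ^ 3 / 6)) t := by
    intro t
    have h := ((((hasDerivAt_pow 2 t).div_const 2).const_sub 1).add
      ((hasDerivAt_pow 4 t).div_const 24)).sub (Real.hasDerivAt_cos t)
    refine HasDerivAt.congr_deriv h ?_
    norm_num; ring
  have m : MonotoneOn (fun t : ℝ => 1 - t ^ 2 / 2 + t ^ 4 / 24 - Real.cos t) (Set.Ici 0) := by
    apply monotoneOn_of_deriv_nonneg (convex_Ici 0)
    · exact fun t _ => (hd t).continuousAt.continuousWithinAt
    · exact fun t _ => (hd t).differentiableAt.differentiableWithinAt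
    · intro t ht
      rw [interior_Ici] at ht
      rw [(hd t).deriv]
      have := Real.sin_ge_sub_cube (le_of_lt ht)
      linarith
  have := m (Set.mem_Ici.2 le_rfl) (Set.mem_Ici.2 hx) hx
  norm_num at this
  linarith

theorem sin_le_taylor {x : ℝ} (hx : 0 ≤ x) :
    Real.sin x ≤ x - x ^ 3 / 6 + x ^ 5 / 120 := by
  have hd : ∀ t : ℝ, HasDerivAt (fun t : ℝ => t - t ^ 3 / 6 + t ^ 5 / 120 - Real.sin t)
      (1 - t ^ 2 / 2 + t ^ 4 / 24 - Real.cos t) t := by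
    intro t
    have h := (((hasDerivAt_id t).sub ((hasDerivAt_pow 3 t).div_const 6)).add
      ((hasDerivAt_pow 5 t).div_const 120)).sub (Real.hasDerivAt_sin t)
    refine HasDerivAt.congr_deriv h ?_
    norm_num; ring
  have m : MonotoneOn (fun t : ℝ => t - t ^ 3 / 6 + t ^ 5 / 120 - Real.sin t) (Set.Ici 0) := by
    apply monotoneOn_of_deriv_nonneg (convex_Ici 0)
    · exact fun t _ => (hd t).continuousAt.continuousWithinAt
    · exact fun t _ => (hd t).differentiableAt.differentiableWithinAt
    · intro t ht
      rw [interior_Ici] at ht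
      rw [(hd t).deriv]
      have := cos_le_taylor (le_of_lt ht)
      linarith
  have := m (Set.mem_Ici.2 le_rfl) (Set.mem_Ici.2 hx) hx
  norm_num at this
  linarith

theorem sin_le_aux {x : ℝ} (hx : 0 ≤ x) (h : x ≤ Real.pi) :
    Real.sin x ≤ x - x ^ 3 / 10 := by
  rcases le_total x (2.82 : ℝ) with h3 | h3
  · have t := sin_le_taylor hx
    have h8 : 0 ≤ 8 - x ^ 2 := by nlinarith
    have : 0 ≤ x ^ 3 * (8 - x ^ 2) := mul_nonneg (by positivity) h8
    nlinarith
  · have s : Real.sin x ≤ Real.pi - x := by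
      rw [← Real.sin_pi_sub]; exact Real.sin_le (by linarith)
    have p1 := Real.pi_gt_three
    have p2 := Real.pi_lt_d2
    generalize Real.pi = p at *
    have q : 0 ≤ p * (10 - p ^ 2) := mul_nonneg (by linarith) (by nlinarith)
    have r : 0 ≤ (p - x) * (p ^ 2 + p * x + x ^ 2 - 20) :=
      mul_nonneg (by linarith) (by nlinarith)
    nlinarith

/-- For every `c ∈ ℝ` and `y ∈ [-π - c, π - c]`,
`(φ(y; c) - η₁(y; c)) (φ(y; c) - η₂(y; c)) ≤ 0`. -/
theorem phi_generalised_sector (c y : ℝ)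
    (h1 : -Real.pi - c ≤ y) (h2 : y ≤ Real.pi - c) :
    (phi y c - eta1 y c) * (phi y c - eta2 y c) ≤ 0 := by
  have e1 : phi y c - eta1 y c = Real.sin (y + c) - ((y + c) - (y + c) ^ 3 / 6) := by
    unfold phi eta1; ring
  have e2 : phi y c - eta2 y c = Real.sin (y + c) - ((y + c) - (y + c) ^ 3 / 10) := by
    unfold phi eta2; ring
  rw [e1, e2]
  have a1 : -Real.pi ≤ y + c := by linarith
  have a2 : y + c ≤ Real.pi := by linarith
  generalize y + c = x at *
  rcases le_total 0 x with hx | hx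
  · have l := Real.sin_ge_sub_cube hx
    have u := sin_le_aux hx a2
    exact mul_nonpos_of_nonneg_of_nonpos (by linarith) (by linarith)
  · have hx' : 0 ≤ -x := by linarith
    have l := Real.sin_ge_sub_cube hx'
    have u := sin_le_aux hx' (by linarith)
    rw [Real.sin_neg] at l u
    exact mul_nonpos_of_nonpos_of_nonneg (by nlinarith) (by nlinarith)
end

section
/- Let n, m ∈ ℕ, A an n×n real matrix, B an n×m real matrix, r = (r₁,…,r_m) real polynomials in (φ, δ) ∈ ℝᵐ × ℝⁿ, a = (a₁,…,a_m) real polynomials in δ, and φ₀ : ℝⁿ → ℝᵐ a map such that r_j(φ₀(δ), δ) ≤ 0 for all j whenever a_j(δ) ≤ 0 for all j. Suppose V, σ₂ are real polynomials in δ with σ₂ strictly positive definite, s₁, s₂ are vectors of m SOS polynomials in (φ, δ), and −∇V(δ)·(Aδ + Bφ) − σ₂(δ) + s₁(φ,δ)ᵀ r(φ,δ) + s₂(φ,δ)ᵀ a(δ) is SOS in (δ, φ). Then for every δ ≠ 0 with a_j(δ) ≤ 0 for all j, the derivative of V along the vector field f(δ) := Aδ + Bφ₀(δ) satisfies ∇V(δ)·f(δ)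 ≤ −σ₂(δ) < 0. -/
open MvPolynomial Matrix

/-- A real multivariate polynomial is a sum of squares (SOS) if it is a finite
sum of squares of real polynomials. -/
def IsSOS {σ : Type*} (p : MvPolynomial σ ℝ) : Prop :=
  ∃ (w : ℕ) (h : Fin w → MvPolynomial σ ℝ), p = ∑ i, (h i) ^ 2

/-- Under the SOS certificate with strictly positive definite `σ₂`
and a map `φ₀` satisfying the sector bounds `r_j(φ₀(δ), δ) ≤ 0` whenever
`a_j(δ) ≤ 0` for all `j`, the derivative of `V` along the vector field
`f(δ) = Aδ + Bφ₀(δ)` satisfies `∇V(δ)·f(δ) ≤ −σ₂(δ) < 0` for every `δ ≠ 0`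
with `a_j(δ) ≤ 0` for all `j`.
Polynomials in `(φ, δ)` are indexed by `Fin m ⊕ Fin n` (`inl` = `φ`-variables,
`inr` = `δ`-variables). -/
theorem sos_certificate_negative_derivative (n m : ℕ)
    (A : Matrix (Fin n) (Fin n) ℝ) (B : Matrix (Fin n) (Fin m) ℝ)
    (r : Fin m → MvPolynomial (Fin m ⊕ Fin n) ℝ)
    (a : Fin m → MvPolynomial (Fin n) ℝ)
    (φ₀ : (Fin n → ℝ) → (Fin m → ℝ))
    (hsec : ∀ δ : Fin n → ℝ, (∀ j, eval δ (a j) ≤ 0) →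
      ∀ j, eval (Sum.elim (φ₀ δ) δ) (r j) ≤ 0)
    (V σ₂ : MvPolynomial (Fin n) ℝ)
    (hσ₂ : ∀ x : Fin n → ℝ, x ≠ 0 → 0 < eval x σ₂)
    (s₁ s₂ : Fin m → MvPolynomial (Fin m ⊕ Fin n) ℝ)
    (hs₁ : ∀ j, IsSOS (s₁ j)) (hs₂ : ∀ j, IsSOS (s₂ j))
    (hSOS : ∃ q : MvPolynomial (Fin m ⊕ Fin n) ℝ, IsSOS q ∧
      ∀ (φ : Fin m → ℝ) (δ : Fin n → ℝ),
        eval (Sum.elim φ δ) q =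
          -(∑ i, eval δ (pderiv i V) * (A.mulVec δ + B.mulVec φ) i)
            - eval δ σ₂
            + ∑ j, eval (Sum.elim φ δ) (s₁ j) * eval (Sum.elim φ δ) (r j)
            + ∑ j, eval (Sum.elim φ δ) (s₂ j) * eval δ (a j)) :
    ∀ δ : Fin n → ℝ, δ ≠ 0 → (∀ j, eval δ (a j) ≤ 0) →
      (∑ i, eval δ (pderiv i V) * (A.mulVec δ + B.mulVec (φ₀ δ)) i) ≤ -eval δ σ₂
        ∧ -eval δ σ₂ < 0 := by
  have hnn : ∀ (p : MvPolynomial (Fin m ⊕ Fin n) ℝ), IsSOS p → ∀ x, 0 ≤ eval x p := by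
    rintro p ⟨w, h, rfl⟩ x
    rw [map_sum]
    refine Finset.sum_nonneg fun i _ => ?_
    rw [map_pow]
    exact sq_nonneg _
  intro δ hδ ha
  obtain ⟨q, hq, hqe⟩ := hSOS
  have h0 := hnn q hq (Sum.elim (φ₀ δ) δ)
  rw [hqe] at h0
  have h1 : ∑ j, eval (Sum.elim (φ₀ δ) δ) (s₁ j) * eval (Sum.elim (φ₀ δ) δ) (r j) ≤ 0 :=
    Finset.sum_nonpos fun j _ =>
      mul_nonpos_of_nonneg_of_nonpos (hnn _ (hs₁ j) _) (hsec δ ha j)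
  have h2 : ∑ j, eval (Sum.elim (φ₀ δ) δ) (s₂ j) * eval δ (a j) ≤ 0 :=
    Finset.sum_nonpos fun j _ =>
      mul_nonpos_of_nonneg_of_nonpos (hnn _ (hs₂ j) _) (ha j)
  have h3 := hσ₂ δ hδ
  constructor <;> linarith
end

section
/- (Lyapunov asymptotic stability theorem.) Let f : ℝⁿ → ℝⁿ be continuous with f(0) = 0, let U ⊆ ℝⁿ be an open set containing 0, and let V : ℝⁿ → ℝ be continuously differentiable with V(0) = 0, V(x) > 0 for all x ∈ U \ {0}, and ∇V(x)·f(x) < 0 for all x ∈ U \ {0}. Then the origin is asymptotically stable for δ̇ = f(δ): (i) for every ε > 0 there exists η > 0 such that every solution with ‖δ(0)‖ < η satisfies ‖δ(t)‖ < ε for all t ≥ 0, and (ii) there exists ρ > 0 such that every solution with ‖δ(0)‖ < ρ satisfies δ(t) → 0 as t → ∞. -/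
open scoped RealInnerProductSpace

theorem aux_decay {n : ℕ}
    (f : EuclideanSpace ℝ (Fin n) → EuclideanSpace ℝ (Fin n))
    (V : EuclideanSpace ℝ (Fin n) → ℝ) (hV : ContDiff ℝ 1 V)
    (δ : ℝ → EuclideanSpace ℝ (Fin n))
    (hδ : ∀ t ≥ (0 : ℝ), HasDerivWithinAt δ (f (δ t)) (Set.Ici 0) t)
    (c T : ℝ) (hT : 0 ≤ T)
    (hc : ∀ s, 0 < s → s < T → ⟪gradient V (δ s), f (δ s)⟫ ≤ c) :
    V (δ T) - V (δ 0) ≤ c * T := by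
  have hcont : ContinuousOn δ (Set.Ici 0) := fun t ht => (hδ t ht).continuousWithinAt
  have hd : ∀ s, 0 < s → HasDerivAt (fun t => V (δ t)) ⟪gradient V (δ s), f (δ s)⟫ s := by
    intro s hs
    have h1 : HasDerivAt δ (f (δ s)) s := (hδ s hs.le).hasDerivAt (Ici_mem_nhds hs)
    have h2 : DifferentiableAt ℝ V (δ s) := (hV.differentiable (by norm_num)) _
    have h3 := h2.hasGradientAt.hasFDerivAt.comp_hasDerivAt s h1
    simp only [InnerProductSpace.toDual_apply_apply] at h3
    exact h3
  have := Convex.image_sub_le_mul_sub_of_deriv_le (f := fun t => V (δ t)) (convex_Icc 0 T)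
    (hV.continuous.comp_continuousOn (hcont.mono Set.Icc_subset_Ici_self))
    (by
      rw [interior_Icc]
      intro s hs
      exact (hd s hs.1).differentiableAt.differentiableWithinAt)
    (C := c)
    (by
      rw [interior_Icc]
      intro s hs
      rw [(hd s hs.1).deriv]
      exact hc s hs.1 hs.2) 0 (by simp [hT]) T (by simp [hT]) hT
  simpa using this

/-- Lyapunov asymptotic stability theorem. If `f` is continuous
with `f 0 = 0`, `U` is an open neighborhood of `0`, and `V` is `C¹` with
`V 0 = 0`, `V > 0` on `U \ {0}` and `⟪∇V(x), f(x)⟫ < 0` on `U \ {0}`, then the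
origin is asymptotically stable for `δ̇ = f(δ)`: (i) Lyapunov stability, and
(ii) local attractivity. Solutions are differentiable maps on `[0, ∞)`. -/
theorem lyapunov_asymptotic_stability (n : ℕ)
    (f : EuclideanSpace ℝ (Fin n) → EuclideanSpace ℝ (Fin n))
    (hf : Continuous f) (hf0 : f 0 = 0)
    (U : Set (EuclideanSpace ℝ (Fin n))) (hU : IsOpen U)
    (h0U : (0 : EuclideanSpace ℝ (Fin n)) ∈ U)
    (V : EuclideanSpace ℝ (Fin n) → ℝ) (hV : ContDiff ℝ 1 V) (hV0 : V 0 = 0)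
    (hVpos : ∀ x ∈ U, x ≠ 0 → 0 < V x)
    (hVdec : ∀ x ∈ U, x ≠ 0 → ⟪gradient V x, f x⟫ < 0) :
    (∀ ε > 0, ∃ η > 0, ∀ δ : ℝ → EuclideanSpace ℝ (Fin n),
        (∀ t ≥ (0 : ℝ), HasDerivWithinAt δ (f (δ t)) (Set.Ici 0) t) →
        ‖δ 0‖ < η → ∀ t ≥ (0 : ℝ), ‖δ t‖ < ε) ∧
    (∃ ρ > 0, ∀ δ : ℝ → EuclideanSpace ℝ (Fin n),
        (∀ t ≥ (0 : ℝ), HasDerivWithinAt δ (f (δ t)) (Set.Ici 0) t) →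
        ‖δ 0‖ < ρ → Filter.Tendsto δ Filter.atTop (nhds 0)) := by
  have hg : Continuous (fun x => ⟪gradient V x, f x⟫) := by
    have h1 : Continuous (gradient V) := by
      unfold gradient
      exact (LinearIsometryEquiv.continuous _).comp (hV.continuous_fderiv (by norm_num))
    exact h1.inner hf
  have hgle : ∀ x ∈ U, ⟪gradient V x, f x⟫ ≤ 0 := by
    intro x hx
    by_cases h : x = 0
    · simp [h, hf0]
    · exact (hVdec x hx h).le
  have hVnn : ∀ x ∈ U, 0 ≤ V x := by
    intro x hx
    by_cases h : x = 0
    · simp [h, hV0]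
    · exact (hVpos x hx h).le
  obtain ⟨R, hR, hRU⟩ := Metric.nhds_basis_closedBall.mem_iff.1 (hU.mem_nhds h0U)
  have stab : (∀ ε > 0, ∃ η > 0, ∀ δ : ℝ → EuclideanSpace ℝ (Fin n),
        (∀ t ≥ (0 : ℝ), HasDerivWithinAt δ (f (δ t)) (Set.Ici 0) t) →
        ‖δ 0‖ < η → ∀ t ≥ (0 : ℝ), ‖δ t‖ < ε) := by
    intro ε hε
    set r := min R ε with hr
    have hr0 : 0 < r := lt_min hR hε
    have hrU : ∀ x : EuclideanSpace ℝ (Fin n), ‖x‖ ≤ r → x ∈ U := fun x hx =>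
      hRU (by simpa using hx.trans (min_le_left _ _))
    obtain ⟨m, hm, hmV⟩ := (isCompact_sphere (0 : EuclideanSpace ℝ (Fin n)) r).exists_forall_le'
      (f := V) hV.continuous.continuousOn (a := 0) (by
        intro x hx
        have hx' : ‖x‖ = r := by simpa using hx
        exact hVpos x (hrU x hx'.le) (by rintro rfl; simp at hx'; linarith))
    obtain ⟨η, hη, hηV⟩ := Metric.continuousAt_iff.1 (hV.continuous.continuousAt (x := 0)) m hm
    refine ⟨min η r, lt_min hη hr0, fun δ hδ h0 => ?_⟩
    have hcont : ContinuousOn δ (Set.Ici 0) := fun t ht => (hδ t ht).continuousWithinAt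
    by_contra! hcon
    obtain ⟨t, ht, hte⟩ := hcon
    have hV0m : V (δ 0) < m := by
      have := hηV (x := δ 0) (by simpa using h0.trans_le (min_le_left _ _))
      rw [hV0, Real.dist_eq, sub_zero] at this
      exact (le_abs_self _).trans_lt this
    have hncont : ContinuousOn (fun s => ‖δ s‖) (Set.Icc 0 t) :=
      (hcont.mono Set.Icc_subset_Ici_self).norm
    let S : Set ℝ := Set.Icc 0 t ∩ (fun s => ‖δ s‖) ⁻¹' {r}
    have hSc : IsCompact S := isCompact_Icc.of_isClosed_subset
      (hncont.preimage_isClosed_of_isClosed isClosed_Icc isClosed_singleton) Set.inter_subset_left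
    have hSne : S.Nonempty := by
      obtain ⟨s, hs, hs'⟩ := intermediate_value_Icc ht hncont
        (show r ∈ _ from ⟨(h0.trans_le (min_le_right _ _)).le, (min_le_right _ _).trans hte⟩)
      exact ⟨s, hs, hs'⟩
    obtain ⟨T, ⟨⟨hT0, hTt⟩, hTr⟩, hTl⟩ := hSc.exists_isLeast hSne
    have hlt : ∀ s, 0 < s → s < T → ‖δ s‖ ≤ r := by
      intro s hs hsT
      by_contra! hsr
      obtain ⟨u, hu, hu'⟩ := intermediate_value_Icc hs.le
        (hncont.mono (Set.Icc_subset_Icc_right (hsT.le.trans hTt)))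
        (show r ∈ _ from ⟨(h0.trans_le (min_le_right _ _)).le, hsr.le⟩)
      have := hTl (show u ∈ S from ⟨⟨hu.1, hu.2.trans (hsT.le.trans hTt)⟩, hu'⟩)
      linarith [hu.2]
    have h1 := aux_decay f V hV δ hδ 0 T hT0 (fun s hs hsT => hgle _ (hrU _ (hlt s hs hsT)))
    have h2 := hmV (δ T) (by simpa using hTr)
    linarith
  refine ⟨stab, ?_⟩
  obtain ⟨ρ, hρ, hρs⟩ := stab R hR
  refine ⟨ρ, hρ, fun δ hδ h0 => ?_⟩
  have hin := hρs δ hδ h0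
  have hinU : ∀ t ≥ 0, δ t ∈ U := fun t ht => hRU (by simpa using (hin t ht).le)
  rw [Metric.tendsto_atTop]
  intro ε hε
  obtain ⟨η, hη, hηs⟩ := stab ε hε
  by_cases hex : ∃ T ≥ 0, ‖δ T‖ < η
  · obtain ⟨T, hT, hTη⟩ := hex
    refine ⟨T, fun t ht => ?_⟩
    have := hηs (fun s => δ (s + T)) (by
      intro s hs
      have h1 := hδ (s + T) (by linarith)
      have h2 : HasDerivWithinAt (fun s : ℝ => s + T) 1 (Set.Ici 0) s :=
        ((hasDerivAt_id s).add_const T).hasDerivWithinAt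
      have h3 := h1.scomp s h2 (fun u hu => by
        simp only [Set.mem_Ici] at hu ⊢
        linarith)
      rw [one_smul] at h3
      exact h3) (by simpa using hTη) (t - T) (by linarith)
    simpa using this
  · exfalso
    push Not at hex
    have hK : IsCompact (Metric.closedBall (0 : EuclideanSpace ℝ (Fin n)) R ∩ {x | η ≤ ‖x‖}) :=
      (isCompact_closedBall _ _).inter_right (isClosed_le continuous_const continuous_norm)
    obtain ⟨c, hc, hcg⟩ := hK.exists_forall_le' (f := fun x => -⟪gradient V x, f x⟫)
      hg.neg.continuousOn (a := 0) (by
        rintro x ⟨hx, hx'⟩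
        have := hVdec x (hRU hx) (by rintro rfl; simp at hx'; linarith)
        linarith)
    have hdec : ∀ T ≥ 0, V (δ T) - V (δ 0) ≤ -c * T := fun T hT =>
      aux_decay f V hV δ hδ (-c) T hT (fun s hs _ => by
        have := hcg (δ s) ⟨by simpa using (hin s hs.le).le, hex s hs.le⟩
        linarith)
    have hv0 := hVnn _ (hinU 0 le_rfl)
    have hT : 0 ≤ (V (δ 0) + 1) / c := by positivity
    have h1 := hdec _ hT
    have h2 := hVnn _ (hinU _ hT)
    have h3 : -c * ((V (δ 0) + 1) / c) = -(V (δ 0) + 1) := by field_simp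
    linarith
end

section
/- (Theorem 1.) Let n, m ∈ ℕ, A an n×n real matrix, B an n×m real matrix. Let a = (a₁,…,a_m) be real polynomials in δ ∈ ℝⁿ with a_j(0) < 0 for all j, and r = (r₁,…,r_m) real polynomials in (φ, δ) ∈ ℝᵐ × ℝⁿ. Let φ₀ : ℝⁿ → ℝᵐ be continuous with φ₀(0) = 0 and such that r_j(φ₀(δ), δ) ≤ 0 for all j whenever a_j(δ) ≤ 0 for all j. Suppose there exist: a real polynomial V in δ with V(0) = 0; vectors s₁, s₂ of m SOS polynomials in (φ, δ); and strictly positive definite polynomials σ₁, σ₂ in δ; such that V − σ₁ is SOS in δ, and −∇V(δ)·(Aδ + Bφ) − σ₂(δ) + s₁(φ,δ)ᵀ r(φ,δ) + s₂(φ,δ)ᵀ a(δ) is SOS in (δ, φ). Then the origin is asymptotically stable in a finite domain for δ̇ = Aδ + Bφ₀(δ): (i) for every ε > 0 there exists η > 0 such that every solution with ‖δ(0)‖ < η satisfies ‖δ(t)‖ < ε for all t ≥ 0, and (ii) there exists ρ > 0 such that every solution with ‖δ(0)‖ < ρ satisfies δ(t) → 0 as t → ∞. -/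
open MvPolynomial Matrix

/-- The Euclidean norm on `Fin k → ℝ`. -/
noncomputable def eNorm {k : ℕ} (x : Fin k → ℝ) : ℝ := Real.sqrt (∑ i, x i ^ 2)

lemma sos_eval_nonneg {σ : Type*} {p : MvPolynomial σ ℝ} (h : IsSOS p) (x : σ → ℝ) :
    0 ≤ eval x p := by
  obtain ⟨w, h, rfl⟩ := h
  rw [map_sum]
  exact Finset.sum_nonneg fun i _ => by rw [map_pow]; positivity

lemma hasDerivAt_eval_curve {n : ℕ} (p : MvPolynomial (Fin n) ℝ) (x : ℝ → Fin n → ℝ)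
    (x' : Fin n → ℝ) (t : ℝ) (hx : HasDerivAt x x' t) :
    HasDerivAt (fun s => eval (x s) p) (∑ i, eval (x t) (pderiv i p) * x' i) t := by
  induction p using MvPolynomial.induction_on with
  | C c => simpa using hasDerivAt_const t c
  | add p q hp hq =>
    have := hp.add hq
    simp only [map_add, add_mul, Finset.sum_add_distrib]
    exact this
  | mul_X p i hp =>
    have := hp.mul ((hasDerivAt_pi.1 hx) i)
    simp only [map_mul, eval_X]
    refine this.congr_deriv ?_
    simp only [Derivation.leibniz, smul_eq_mul, pderiv_X, map_add, map_mul, eval_X, add_mul,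
      Finset.sum_add_distrib]
    rw [add_comm]
    congr 1
    · rw [Finset.sum_eq_single i]
      · simp
      · intro j _ hj
        simp [Pi.single_apply, hj.symm]
      · simp
    · rw [Finset.sum_mul]
      exact Finset.sum_congr rfl fun j _ => by ring

lemma antitone_along {f u : ℝ → ℝ} {a b : ℝ} (c : ℝ) (hab : a ≤ b)
    (hc : ContinuousOn f (Set.Icc a b))
    (hd : ∀ t ∈ Set.Ioo a b, HasDerivAt f (u t) t) (hu : ∀ t ∈ Set.Ioo a b, u t ≤ -c) :
    f b ≤ f a - c * (b - a) := by
  have h := antitoneOn_of_deriv_nonpos (f := fun t => f t + c * t) (convex_Icc a b)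
    (by fun_prop)
    (by
      rw [interior_Icc]
      intro t ht
      exact (((hd t ht).add ((hasDerivAt_id t).const_mul c)).differentiableAt).differentiableWithinAt)
    (by
      rw [interior_Icc]
      intro t ht
      have h1 : HasDerivAt (fun t => f t + c * t) (u t + c * 1) t :=
        (hd t ht).add ((hasDerivAt_id t).const_mul c)
      rw [h1.deriv]
      linarith [hu t ht])
  have := h (Set.left_mem_Icc.2 hab) (Set.right_mem_Icc.2 hab) hab
  simp only at this
  linarith

lemma stab_aux {n : ℕ} (v u : (Fin n → ℝ) → ℝ) (hv : Continuous v)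
    (hv0 : v 0 = 0) (hvp : ∀ x, x ≠ 0 → 0 < v x) (R : ℝ)
    (hu : ∀ x, ‖x‖ ≤ R → u x ≤ 0) (ε : ℝ) (hε : 0 < ε) (hεR : ε ≤ R) :
    ∃ η > 0, ∀ x : ℝ → Fin n → ℝ, ContinuousOn x (Set.Ici 0) →
      (∀ t > 0, HasDerivAt (fun s => v (x s)) (u (x t)) t) →
      ∀ t₀ ≥ 0, ‖x t₀‖ < η → ∀ t ≥ t₀, ‖x t‖ < ε := by
  obtain ⟨μ, hμ, hμv⟩ : ∃ μ > 0, ∀ x : Fin n → ℝ, ‖x‖ = ε → μ ≤ v x := by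
    rcases (Metric.sphere (0 : Fin n → ℝ) ε).eq_empty_or_nonempty with h | h
    · refine ⟨1, one_pos, fun x hx => ?_⟩
      have : x ∈ Metric.sphere (0 : Fin n → ℝ) ε := by simpa using hx
      simp [h] at this
    · obtain ⟨y, hy, hmin⟩ := (isCompact_sphere (0 : Fin n → ℝ) ε).exists_isMinOn h hv.continuousOn
      refine ⟨v y, hvp y ?_, fun x hx => hmin (by simpa using hx)⟩
      rintro rfl
      simp at hy
      linarith
  have hnear : ∀ᶠ x in nhds (0 : Fin n → ℝ), v x < μ :=
    hv.continuousAt.eventually_lt continuousAt_const (by simpa [hv0] using hμ)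
  obtain ⟨η₀, hη₀, hball⟩ := Metric.eventually_nhds_iff.1 hnear
  refine ⟨min η₀ ε, lt_min hη₀ hε, fun x hx hd t₀ ht₀ hxt t ht => ?_⟩
  by_contra hcon
  push Not at hcon
  have hcn : ContinuousOn (fun s => ‖x s‖) (Set.Icc t₀ t) :=
    (hx.mono fun s hs => le_trans ht₀ hs.1).norm
  set S := Set.Icc t₀ t ∩ (fun s => ‖x s‖) ⁻¹' Set.Ici ε with hS
  have hSc : IsClosed S := hcn.preimage_isClosed_of_isClosed isClosed_Icc isClosed_Ici
  have hSn : S.Nonempty := ⟨t, ⟨ht, le_rfl⟩, hcon⟩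
  have hSb : BddBelow S := ⟨t₀, fun s hs => hs.1.1⟩
  have hT := hSc.csInf_mem hSn hSb
  set T := sInf S with hTdef
  have hlt : ∀ s ∈ Set.Ico t₀ T, ‖x s‖ < ε := by
    intro s hs
    by_contra h
    push Not at h
    exact absurd (csInf_le hSb ⟨⟨hs.1, hs.2.le.trans hT.1.2⟩, h⟩) (not_le.2 hs.2)
  have hT0 : t₀ < T := by
    rcases hT.1.1.eq_or_lt with h | h
    · have h2 : ε ≤ ‖x T‖ := hT.2
      rw [← h] at h2
      linarith [min_le_right η₀ ε]
    · exact h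
  have hTε : ‖x T‖ = ε := by
    refine le_antisymm ?_ hT.2
    have hcl : ContinuousOn (fun s => ‖x s‖) (closure (Set.Ico t₀ T)) := by
      rw [closure_Ico hT0.ne]
      exact hcn.mono (Set.Icc_subset_Icc_right hT.1.2)
    exact le_on_closure (fun s hs => (hlt s hs).le) hcl continuousOn_const
      (by rw [closure_Ico hT0.ne]; exact ⟨hT0.le, le_rfl⟩)
  have := antitone_along (f := fun s => v (x s)) (u := fun s => u (x s)) 0 hT0.le
    (hv.comp_continuousOn (hx.mono fun s hs => le_trans ht₀ hs.1))
    (fun s hs => hd s (lt_of_le_of_lt ht₀ hs.1))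
    (fun s hs => by
      rw [neg_zero]; exact hu _ ((hlt s ⟨hs.1.le, hs.2⟩).le.trans hεR))
  have h1 := hμv _ hTε
  have h2 : v (x t₀) < μ := hball (by simpa using hxt.trans_le (min_le_left _ _))
  rw [zero_mul, sub_zero] at this
  linarith

lemma attr_aux {n : ℕ} (v u : (Fin n → ℝ) → ℝ) (hv : Continuous v) (huc : Continuous u)
    (hv0 : v 0 = 0) (hvp : ∀ x, x ≠ 0 → 0 < v x) (R : ℝ) (hR : 0 < R)
    (hu : ∀ x, ‖x‖ ≤ R → u x ≤ 0) (hun : ∀ x, ‖x‖ ≤ R → x ≠ 0 → u x < 0) :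
    ∃ η > 0, ∀ x : ℝ → Fin n → ℝ, ContinuousOn x (Set.Ici 0) →
      (∀ t > 0, HasDerivAt (fun s => v (x s)) (u (x t)) t) →
      ‖x 0‖ < η → Filter.Tendsto x Filter.atTop (nhds 0) := by
  obtain ⟨η, hη, H⟩ := stab_aux v u hv hv0 hvp R hu R hR le_rfl
  refine ⟨η, hη, fun x hx hd hx0 => ?_⟩
  have hin := H x hx hd 0 le_rfl hx0
  rw [Metric.tendsto_atTop]
  intro ε hε
  obtain ⟨η', hη', H'⟩ := stab_aux v u hv hv0 hvp R hu (min ε R) (lt_min hε hR) (min_le_right _ _)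
  obtain ⟨t₁, ht₁, hxt₁⟩ : ∃ t₁ ≥ 0, ‖x t₁‖ < η' := by
    by_contra hcon
    push Not at hcon
    have hK : IsCompact (Metric.closedBall (0 : Fin n → ℝ) R ∩ {y | η' ≤ ‖y‖}) :=
      (isCompact_closedBall _ _).inter_right (isClosed_le continuous_const continuous_norm)
    have hmem : ∀ t ≥ 0, x t ∈ Metric.closedBall (0 : Fin n → ℝ) R ∩ {y | η' ≤ ‖y‖} :=
      fun t ht => ⟨by simpa using (hin t ht).le, hcon t ht⟩
    obtain ⟨y, hy, hmax⟩ := hK.exists_isMaxOn ⟨_, hmem 0 le_rfl⟩ huc.continuousOn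
    have hyneg : u y < 0 := by
      refine hun y (by simpa using hy.1) ?_
      rintro rfl
      have := hy.2
      simp at this
      linarith
    have hvn : ∀ z, 0 ≤ v z := fun z => by
      by_cases h : z = 0
      · rw [h, hv0]
      · exact (hvp z h).le
    have hb : 0 ≤ (v (x 0) + 1) / (-u y) := div_nonneg (by linarith [hvn (x 0)]) (by linarith)
    have := antitone_along (f := fun s => v (x s)) (u := fun s => u (x s)) (-u y) hb
      (hv.comp_continuousOn (hx.mono fun s hs => hs.1))
      (fun s hs => hd s hs.1)
      (fun s hs => by rw [neg_neg]; exact hmax (hmem s hs.1.le))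
    simp only [sub_zero] at this
    rw [mul_div_cancel₀ _ (by linarith : -u y ≠ 0)] at this
    linarith [hvn (x ((v (x 0) + 1) / (-u y)))]
  refine ⟨t₁, fun t ht => ?_⟩
  rw [dist_zero_right]
  exact (H' x hx hd t₁ ht₁ hxt₁ t ht).trans_le (min_le_left _ _)

lemma norm_le_eNorm {k : ℕ} (x : Fin k → ℝ) : ‖x‖ ≤ eNorm x := by
  refine (pi_norm_le_iff_of_nonneg (Real.sqrt_nonneg _)).2 fun i => ?_
  refine Real.le_sqrt_of_sq_le ?_
  rw [Real.norm_eq_abs, sq_abs]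
  exact Finset.single_le_sum (f := fun i => x i ^ 2) (fun i _ => sq_nonneg _) (Finset.mem_univ i)

/-- Theorem 1: Under the SOS certificate — `V(0) = 0`,
`V − σ₁` SOS with `σ₁` strictly positive definite, `s₁, s₂` SOS multiplier
vectors, `σ₂` strictly positive definite, and
`−∇V(δ)·(Aδ + Bφ) − σ₂(δ) + s₁ᵀr + s₂ᵀa` SOS in `(δ, φ)` — with `a_j(0) < 0`
for all `j` and a continuous `φ₀` with `φ₀ 0 = 0` satisfying the sector bounds
`r_j(φ₀(δ), δ) ≤ 0` whenever `a_j(δ) ≤ 0` for all `j`, the origin is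
asymptotically stable in a finite domain for `δ̇ = Aδ + Bφ₀(δ)`:
(i) Lyapunov stability and (ii) local attractivity hold.
Polynomials in `(φ, δ)` are indexed by `Fin m ⊕ Fin n` (`inl` = `φ`-variables,
`inr` = `δ`-variables); norms are Euclidean. -/
theorem sos_certificate_asymptotic_stability (n m : ℕ)
    (A : Matrix (Fin n) (Fin n) ℝ) (B : Matrix (Fin n) (Fin m) ℝ)
    (a : Fin m → MvPolynomial (Fin n) ℝ)
    (ha0 : ∀ j, eval (0 : Fin n → ℝ) (a j) < 0)
    (r : Fin m → MvPolynomial (Fin m ⊕ Fin n) ℝ)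
    (φ₀ : (Fin n → ℝ) → (Fin m → ℝ))
    (hφ₀c : Continuous φ₀) (hφ₀0 : φ₀ 0 = 0)
    (hsec : ∀ δ : Fin n → ℝ, (∀ j, eval δ (a j) ≤ 0) →
      ∀ j, eval (Sum.elim (φ₀ δ) δ) (r j) ≤ 0)
    (V : MvPolynomial (Fin n) ℝ) (hV0 : eval (0 : Fin n → ℝ) V = 0)
    (s₁ s₂ : Fin m → MvPolynomial (Fin m ⊕ Fin n) ℝ)
    (hs₁ : ∀ j, IsSOS (s₁ j)) (hs₂ : ∀ j, IsSOS (s₂ j))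
    (σ₁ σ₂ : MvPolynomial (Fin n) ℝ)
    (hσ₁ : ∀ x : Fin n → ℝ, x ≠ 0 → 0 < eval x σ₁)
    (hσ₂ : ∀ x : Fin n → ℝ, x ≠ 0 → 0 < eval x σ₂)
    (hVσ₁ : IsSOS (V - σ₁))
    (hSOS : ∃ q : MvPolynomial (Fin m ⊕ Fin n) ℝ, IsSOS q ∧
      ∀ (φ : Fin m → ℝ) (δ : Fin n → ℝ),
        eval (Sum.elim φ δ) q =
          -(∑ i, eval δ (pderiv i V) * (A.mulVec δ + B.mulVec φ) i)
            - eval δ σ₂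
            + ∑ j, eval (Sum.elim φ δ) (s₁ j) * eval (Sum.elim φ δ) (r j)
            + ∑ j, eval (Sum.elim φ δ) (s₂ j) * eval δ (a j)) :
    (∀ ε > 0, ∃ η > 0, ∀ δ : ℝ → (Fin n → ℝ),
        (∀ t ≥ (0 : ℝ), HasDerivWithinAt δ
          (A.mulVec (δ t) + B.mulVec (φ₀ (δ t))) (Set.Ici 0) t) →
        eNorm (δ 0) < η → ∀ t ≥ (0 : ℝ), eNorm (δ t) < ε) ∧
    (∃ ρ > 0, ∀ δ : ℝ → (Fin n → ℝ),
        (∀ t ≥ (0 : ℝ), HasDerivWithinAt δ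
          (A.mulVec (δ t) + B.mulVec (φ₀ (δ t))) (Set.Ici 0) t) →
        eNorm (δ 0) < ρ → Filter.Tendsto δ Filter.atTop (nhds 0)) := by
  obtain ⟨q, hq, hqe⟩ := hSOS
  set u : (Fin n → ℝ) → ℝ := fun δ =>
    ∑ i, eval δ (pderiv i V) * (A.mulVec δ + B.mulVec (φ₀ δ)) i with hu
  have hev : ∀ p : MvPolynomial (Fin n) ℝ, Continuous fun x => eval x p :=
    fun p => MvPolynomial.continuous_eval p
  have huc : Continuous u := by
    refine continuous_finsetSum _ fun i _ => (hev _).mul ?_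
    have h1 : Continuous fun δ => A.mulVec δ + B.mulVec (φ₀ δ) :=
      (Continuous.matrix_mulVec continuous_const continuous_id).add
        (Continuous.matrix_mulVec continuous_const hφ₀c)
    exact (continuous_apply i).comp h1
  have hvp : ∀ x, x ≠ 0 → 0 < eval x V := by
    intro x hx
    have := sos_eval_nonneg hVσ₁ x
    rw [map_sub] at this
    linarith [hσ₁ x hx]
  have hnear : ∀ᶠ x in nhds (0 : Fin n → ℝ), ∀ j, eval x (a j) < 0 :=
    Filter.eventually_all.2 fun j =>
      (hev (a j)).continuousAt.eventually_lt continuousAt_const (ha0 j)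
  obtain ⟨R₀, hR₀, hball⟩ := Metric.eventually_nhds_iff.1 hnear
  have hun : ∀ x, ‖x‖ ≤ R₀ / 2 → x ≠ 0 → u x < 0 := by
    intro x hxR hx
    have ha : ∀ j, eval x (a j) ≤ 0 := fun j =>
      (hball (by rw [dist_zero_right]; linarith) j).le
    have hr := hsec x ha
    have h1 := hqe (φ₀ x) x
    have h2 := sos_eval_nonneg hq (Sum.elim (φ₀ x) x)
    have h3 : ∑ j, eval (Sum.elim (φ₀ x) x) (s₁ j) * eval (Sum.elim (φ₀ x) x) (r j) ≤ 0 :=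
      Finset.sum_nonpos fun j _ =>
        mul_nonpos_of_nonneg_of_nonpos (sos_eval_nonneg (hs₁ j) _) (hr j)
    have h4 : ∑ j, eval (Sum.elim (φ₀ x) x) (s₂ j) * eval x (a j) ≤ 0 :=
      Finset.sum_nonpos fun j _ =>
        mul_nonpos_of_nonneg_of_nonpos (sos_eval_nonneg (hs₂ j) _) (ha j)
    have h5 := hσ₂ x hx
    simp only [hu]
    linarith
  have hu0 : ∀ x, ‖x‖ ≤ R₀ / 2 → u x ≤ 0 := by
    intro x hxR
    by_cases hx : x = 0
    · subst hx
      simp [hu, hφ₀0]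
    · exact (hun x hxR hx).le
  have hR : 0 < R₀ / 2 := by linarith
  have hcont : ∀ δ : ℝ → (Fin n → ℝ),
      (∀ t ≥ (0 : ℝ), HasDerivWithinAt δ
          (A.mulVec (δ t) + B.mulVec (φ₀ (δ t))) (Set.Ici 0) t) →
      ContinuousOn δ (Set.Ici 0) ∧
      (∀ t > 0, HasDerivAt (fun s => eval (δ s) V) (u (δ t)) t) := fun δ hδ =>
    ⟨fun t ht => (hδ t ht).continuousWithinAt, fun t ht =>
      hasDerivAt_eval_curve V δ _ t ((hδ t ht.le).hasDerivAt (Ici_mem_nhds ht))⟩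
  constructor
  · intro ε hε
    have hec : Continuous (eNorm : (Fin n → ℝ) → ℝ) := by
      unfold eNorm
      fun_prop
    have he0 : ∀ᶠ x in nhds (0 : Fin n → ℝ), eNorm x < ε :=
      hec.continuousAt.eventually_lt continuousAt_const (by simpa [eNorm] using hε)
    obtain ⟨ε', hε', hb⟩ := Metric.eventually_nhds_iff.1 he0
    obtain ⟨η, hη, H⟩ := stab_aux (fun x => eval x V) u (hev V) hV0 hvp (R₀ / 2) hu0
      (min ε' (R₀ / 2)) (lt_min hε' hR) (min_le_right _ _)
    refine ⟨η, hη, fun δ hδ h0 t ht => hb ?_⟩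
    rw [dist_zero_right]
    exact (H δ (hcont δ hδ).1 (hcont δ hδ).2 0 le_rfl ((norm_le_eNorm _).trans_lt h0) t ht).trans_le
      (min_le_left _ _)
  · obtain ⟨η, hη, H⟩ := attr_aux (fun x => eval x V) u (hev V) huc hV0 hvp (R₀ / 2) hR hu0 hun
    exact ⟨η, hη, fun δ hδ h0 =>
      H δ (hcont δ hδ).1 (hcont δ hδ).2 ((norm_le_eNorm _).trans_lt h0)⟩
end
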